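/- Let (X,d) be a b-metric space with constant b ≥ 1, let F ∈ 𝓕 and τ ∈ Υ, and let f_1, …, f_N : X → X be maps, each sending nonempty compact sets to nonempty compact sets, such that for each n and all A, B ∈ H(X) with H(f_n(A),f_n(B)) > 0 one has τ(H(A,B)) + F(H(f_n(A),f_n(B))) ≤ F(H(A,B)). Then the Hutchinson operator T : H(X) → H(X), T(A) = f_1(A) ∪ … ∪ f_N(A), satisfies τ(H(A,B)) + F(H(T(A),T(B))) ≤ F(H(A,B)) for all A, B ∈ H(X) with H(T(A),T(B)) > 0; in particular T is a generalized F-contraction on (H(X), H). -/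

import Mathlib

open Filter Topology Set

/-- A b-metric on `X` with constant `b ≥ 1`. -/
def IsBMetric {X : Type*} (b : ℝ) (d : X → X → ℝ) : Prop :=
  (∀ x y, 0 ≤ d x y) ∧ (∀ x y, d x y = 0 ↔ x = y) ∧
  (∀ x y, d x y = d y x) ∧ (∀ x y z, d x y ≤ b * (d x z + d z y))

/-- Convergence of a sequence with respect to a b-metric `d`. -/
def BConverges {X : Type*} (d : X → X → ℝ) (x : ℕ → X) (l : X) : Prop :=
  Tendsto (fun n => d (x n) l) atTop (𝓝 0)

/-- Cauchyness of a sequence with respect to a b-metric `d`. -/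
def BCauchy {X : Type*} (d : X → X → ℝ) (x : ℕ → X) : Prop :=
  ∀ ε : ℝ, 0 < ε → ∃ N : ℕ, ∀ m ≥ N, ∀ n ≥ N, d (x m) (x n) < ε

/-- Completeness of a b-metric space. -/
def BComplete {X : Type*} (d : X → X → ℝ) : Prop :=
  ∀ x : ℕ → X, BCauchy d x → ∃ l, BConverges d x l

/-- Sequential compactness of a subset of a b-metric space. -/
def BSeqCompact {X : Type*} (d : X → X → ℝ) (A : Set X) : Prop :=
  ∀ x : ℕ → X, (∀ n, x n ∈ A) →
    ∃ a ∈ A, ∃ φ : ℕ → ℕ, StrictMono φ ∧ BConverges d (x ∘ φ) a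

/-- `HX d` is the collection of nonempty compact subsets of `X`. -/
def HX {X : Type*} (d : X → X → ℝ) : Set (Set X) :=
  {A | A.Nonempty ∧ BSeqCompact d A}

/-- Distance from a point to a set: `d(x,B) = inf_{y ∈ B} d(x,y)`. -/
noncomputable def distPtSet {X : Type*} (d : X → X → ℝ) (x : X) (B : Set X) : ℝ :=
  sInf (d x '' B)

/-- The Pompeiu–Hausdorff distance induced by `d`. -/
noncomputable def hausD {X : Type*} (d : X → X → ℝ) (A B : Set X) : ℝ :=
  max (sSup ((fun a => distPtSet d a B) '' A))
    (sSup ((fun y => distPtSet d y A) '' B))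

/-- The class `𝓕` of Wardowski functions: continuous and strictly increasing on `(0,∞)`,
satisfying (F2) and (F3). -/
def MemF (F : ℝ → ℝ) : Prop :=
  ContinuousOn F (Ioi 0) ∧ StrictMonoOn F (Ioi 0) ∧
  (∀ α : ℕ → ℝ, (∀ n, 0 < α n) →
    (Tendsto α atTop (𝓝 0) ↔ Tendsto (fun n => F (α n)) atTop atBot)) ∧
  (∃ h ∈ Ioo (0:ℝ) 1, Tendsto (fun t : ℝ => t ^ h * F t) (𝓝[>] 0) (𝓝 0))

/-- The class `Υ`: positive on `(0,∞)` with `liminf_{t → s} τ(t) > 0` for every `s ≥ 0`,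
the limit being taken within the domain `(0,∞)`. -/
def MemUpsilon (τ : ℝ → ℝ) : Prop :=
  (∀ t : ℝ, 0 < t → 0 < τ t) ∧
  (∀ s : ℝ, 0 ≤ s → 0 < liminf τ (𝓝[Set.Ioi (0:ℝ)] s))

/-- A generalized F-contraction on a b-metric space. -/
def GenFContraction {X : Type*} (d : X → X → ℝ) (f : X → X) (F τ : ℝ → ℝ) : Prop :=
  ∀ x y, 0 < d (f x) (f y) → τ (d x y) + F (d (f x) (f y)) ≤ F (d x y)

theorem distPtSet_le {X : Type*} {b : ℝ} {d : X → X → ℝ} (hd : IsBMetric b d) (x : X)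
    {B : Set X} {y : X} (hy : y ∈ B) : distPtSet d x B ≤ d x y :=
  csInf_le ⟨0, by rintro _ ⟨z, -, rfl⟩; exact hd.1 x z⟩ ⟨y, hy, rfl⟩

theorem distPtSet_anti {X : Type*} {b : ℝ} {d : X → X → ℝ} (hd : IsBMetric b d) (x : X)
    {B C : Set X} (hB : B.Nonempty) (hBC : B ⊆ C) : distPtSet d x C ≤ distPtSet d x B := by
  refine le_csInf (hB.image _) ?_
  rintro _ ⟨y, hy, rfl⟩
  exact distPtSet_le hd x (hBC hy)

/-- The distance to a fixed point is bounded on a compact set. -/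
theorem BSeqCompact.bddAbove_dist {X : Type*} {b : ℝ} (hb : 0 ≤ b) {d : X → X → ℝ}
    (hd : IsBMetric b d) {A : Set X} (hA : BSeqCompact d A) (y : X) :
    ∃ M, ∀ a ∈ A, d a y ≤ M := by
  by_contra! h
  choose x hxA hx using fun n : ℕ => h n
  obtain ⟨a, -, φ, hφ, hconv⟩ := hA x hxA
  have hsmall : ∀ᶠ n in atTop, d (x (φ n)) a < 1 := hconv.eventually_lt_const one_pos
  have hlarge : ∀ᶠ n : ℕ in atTop, b * (1 + d a y) ≤ n :=
    tendsto_natCast_atTop_atTop.eventually_ge_atTop _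
  obtain ⟨n, hn, hn'⟩ := (hsmall.and hlarge).exists
  have hle : (n : ℝ) ≤ φ n := by exact_mod_cast hφ.id_le n
  have htri := hd.2.2.2 (x (φ n)) y a
  have hmul : b * (d (x (φ n)) a + d a y) ≤ b * (1 + d a y) := by gcongr
  linarith [hx (φ n)]

theorem distPtSet_le_sSup {X : Type*} {b : ℝ} (hb : 0 ≤ b) {d : X → X → ℝ}
    (hd : IsBMetric b d) {A B : Set X} (hA : BSeqCompact d A) (hB : B.Nonempty)
    {a : X} (ha : a ∈ A) : distPtSet d a B ≤ sSup ((fun x => distPtSet d x B) '' A) := by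
  obtain ⟨y, hy⟩ := hB
  obtain ⟨M, hM⟩ := hA.bddAbove_dist hb hd y
  refine le_csSup ⟨M, ?_⟩ ⟨a, ha, rfl⟩
  rintro _ ⟨x, hx, rfl⟩
  exact (distPtSet_le hd x hy).trans (hM x hx)

/-- The Hausdorff distance of two unions is at most any common bound of the
Hausdorff distances of the members. -/
theorem hausD_iUnion_le {X ι : Type*} [Nonempty ι] {b : ℝ} (hb : 0 ≤ b) {d : X → X → ℝ}
    (hd : IsBMetric b d) {A B : ι → Set X} (hA : ∀ i, A i ∈ HX d) (hB : ∀ i, B i ∈ HX d)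
    {r : ℝ} (hr : ∀ i, hausD d (A i) (B i) ≤ r) : hausD d (⋃ i, A i) (⋃ i, B i) ≤ r := by
  refine max_le (csSup_le ((nonempty_iUnion.2 ⟨Classical.arbitrary ι, (hA _).1⟩).image _) ?_)
    (csSup_le ((nonempty_iUnion.2 ⟨Classical.arbitrary ι, (hB _).1⟩).image _) ?_)
  · rintro _ ⟨a, ha, rfl⟩
    obtain ⟨i, hi⟩ := mem_iUnion.1 ha
    exact (distPtSet_anti hd a (hB i).1 (subset_iUnion B i)).trans <|
      (distPtSet_le_sSup hb hd (hA i).2 (hB i).1 hi).trans <| (le_max_left _ _).trans (hr i)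
  · rintro _ ⟨y, hy, rfl⟩
    obtain ⟨i, hi⟩ := mem_iUnion.1 hy
    exact (distPtSet_anti hd y (hA i).1 (subset_iUnion A i)).trans <|
      (distPtSet_le_sSup hb hd (hB i).2 (hA i).1 hi).trans <| (le_max_right _ _).trans (hr i)

/-- If each map of a finite family is a generalized F-contraction on `(H(X), H)` with the
same `F` and `τ`, then so is the Hutchinson operator. -/
theorem hutchinson_genF_on_compacts {X : Type*} (b : ℝ) (hb : 1 ≤ b)
    (d : X → X → ℝ) (hd : IsBMetric b d)
    (N : ℕ) (hN : 0 < N) (f : Fin N → X → X) (F τ : ℝ → ℝ)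
    (hF : MemF F) (hτ : MemUpsilon τ)
    (hmaps : ∀ i, ∀ A ∈ HX d, f i '' A ∈ HX d)
    (hf : ∀ i, ∀ A ∈ HX d, ∀ B ∈ HX d, 0 < hausD d (f i '' A) (f i '' B) →
      τ (hausD d A B) + F (hausD d (f i '' A) (f i '' B)) ≤ F (hausD d A B)) :
    ∀ A ∈ HX d, ∀ B ∈ HX d, 0 < hausD d (⋃ i, f i '' A) (⋃ i, f i '' B) →
      τ (hausD d A B) + F (hausD d (⋃ i, f i '' A) (⋃ i, f i '' B)) ≤
        F (hausD d A B) := by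
  intro A hA B hB hpos
  have : Nonempty (Fin N) := ⟨⟨0, hN⟩⟩
  obtain ⟨j, hj⟩ := Finite.exists_max fun i => hausD d (f i '' A) (f i '' B)
  have hle := hausD_iUnion_le (zero_le_one.trans hb) hd (fun i => hmaps i A hA)
    (fun i => hmaps i B hB) hj
  have hj_pos := hpos.trans_le hle
  linarith [hf j A hA B hB hj_pos, hF.2.1.monotoneOn hpos hj_pos hle]
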